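/- Let Θ ⊆ ℝ^p be a convex set and suppose f : ℝ^p → ℝ is bounded below on Θ, admits directional derivatives ∇f(θ, θ'−θ) for all θ, θ' ∈ Θ, and is a composition f = f' ∘ e, where e : ℝ^p → ℝ^d is C-Lipschitz continuous for some C > 0 and f' : ℝ^d → ℝ. Let θ₀ ∈ Θ and for every n ≥ 1 let g_n := g'_n ∘ e, where g'_n is a majorizing first-order surrogate of f' near e(θ_{n−1}) in ℝ^d (g'_n ∈ S_L(f', e(θ_{n−1})) and g'_n ≥ f' everywhere), and let θ_n be a minimizer of g_n over Θ. Then the sequence (f(θ_n)) is non-increasing, and the sequence (θ_n) satisfies the asymptotic stationary point condition: liminf_{n→∞} inf_{θ ∈ Θ, θ ≠ θ_n} ∇f(θ_n, θ−θ_n)/‖θ−θ_n‖₂ ≥ 0. -/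

import Mathlib

open MeasureTheory Filter Set
open scoped BigOperators NNReal Topology

noncomputable section

/-- `ℝ^p` with the Euclidean structure. -/
abbrev E (p : ℕ) := EuclideanSpace ℝ (Fin p)

/-- A function `h` is `L`-smooth when it is differentiable and its gradient is
`L`-Lipschitz continuous. -/
def LSmooth {p : ℕ} (L : ℝ) (h : E p → ℝ) : Prop :=
  Differentiable ℝ h ∧ LipschitzWith L.toNNReal (gradient h)

/-- `g` is `ρ`-strongly convex: `θ ↦ g θ - (ρ/2)‖θ‖²` is convex. -/
def StrongConvex {p : ℕ} (ρ : ℝ) (g : E p → ℝ) : Prop :=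
  ConvexOn ℝ Set.univ (fun θ => g θ - ρ / 2 * ‖θ‖ ^ 2)

/-- `g` is a first-order surrogate of `f` near `κ` in `Θ` (`g ∈ S_L(f,κ)`):
(i) `g θ' ≥ f θ'` for every minimizer `θ'` of `g` over `Θ`; (ii) the
approximation error `h := g - f` is `L`-smooth, `h κ = 0` and `∇h κ = 0`. -/
def Surrogate {p : ℕ} (L : ℝ) (f g : E p → ℝ) (Θ : Set (E p)) (κ : E p) : Prop :=
  (∀ θ' ∈ Θ, IsMinOn g Θ θ' → f θ' ≤ g θ') ∧
  LSmooth L (fun θ => g θ - f θ) ∧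
  g κ - f κ = 0 ∧ gradient (fun θ => g θ - f θ) κ = 0

/-- `g` is a majorizing first-order surrogate of `f` near `κ`:
`g ≥ f` everywhere and the error `h := g - f` is `L`-smooth, `h κ = 0`, `∇h κ = 0`. -/
def MajSurrogate {p : ℕ} (L : ℝ) (f g : E p → ℝ) (κ : E p) : Prop :=
  (∀ θ, f θ ≤ g θ) ∧
  LSmooth L (fun θ => g θ - f θ) ∧
  g κ - f κ = 0 ∧ gradient (fun θ => g θ - f θ) κ = 0

/-- `l` is the directional derivative `∇f(θ, d) = lim_{t→0⁺} (f(θ + t d) - f θ)/t`. -/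
def HasDirDeriv {p : ℕ} (f : E p → ℝ) (θ d : E p) (l : ℝ) : Prop :=
  Tendsto (fun t : ℝ => (f (θ + t • d) - f θ) / t) (𝓝[>] (0:ℝ)) (𝓝 l)

/-- The asymptotic stationary point condition
`liminf_{n→∞} inf_{θ ∈ Θ, θ ≠ θₙ} ∇f(θₙ, θ - θₙ)/‖θ - θₙ‖ ≥ 0`, where `df θ d`
denotes the directional derivative `∇f(θ, d)`, unfolded in ε-N form. -/
def AsympStationary {p : ℕ} (Θ : Set (E p)) (df : E p → E p → ℝ) (θseq : ℕ → E p) : Prop :=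
  ∀ ε > 0, ∃ N : ℕ, ∀ n ≥ N, ∀ θ ∈ Θ, θ ≠ θseq n →
    df (θseq n) (θ - θseq n) / ‖θ - θseq n‖ ≥ -ε

theorem LSmooth.abs_sub_sub_inner_le {p : ℕ} {L : ℝ} (hL : 0 ≤ L) {h : E p → ℝ}
    (hh : LSmooth L h) (x y : E p) :
    |h y - h x - inner ℝ (gradient h x) (y - x)| ≤ L * ‖y - x‖ ^ 2 := by
  have key : ∀ z ∈ segment ℝ x y, ‖fderiv ℝ h z - fderiv ℝ h x‖ ≤ L * ‖y - x‖ := by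
    intro z hz
    have hg : ∀ w, fderiv ℝ h w = InnerProductSpace.toDual ℝ (E p) (gradient h w) := by
      intro w
      simp [gradient]
    rw [hg, hg, ← map_sub, LinearIsometryEquiv.norm_map]
    have h1 := hh.2.dist_le_mul z x
    rw [dist_eq_norm, dist_eq_norm, Real.coe_toNNReal L hL] at h1
    exact h1.trans (mul_le_mul_of_nonneg_left (norm_sub_le_of_mem_segment hz) hL)
  have h2 := (convex_segment x y).norm_image_sub_le_of_norm_hasFDerivWithin_le'
    (fun z _ => (hh.1 z).hasFDerivAt.hasFDerivWithinAt) key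
    (left_mem_segment ℝ x y) (right_mem_segment ℝ x y)
  have h3 : fderiv ℝ h x (y - x) = inner ℝ (gradient h x) (y - x) := by
    simp [gradient]
  rw [h3, Real.norm_eq_abs] at h2
  linarith

theorem LSmooth.norm_gradient_sq_le {p : ℕ} {L : ℝ} (hL : 0 < L) {h : E p → ℝ}
    (hh : LSmooth L h) (hnonneg : ∀ x, 0 ≤ h x) (x : E p) :
    ‖gradient h x‖ ^ 2 ≤ 4 * L * h x := by
  have h1 := hh.abs_sub_sub_inner_le hL.le x (x - (1 / (2 * L)) • gradient h x)
  rw [sub_sub_cancel_left, norm_neg, inner_neg_right, inner_smul_right,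
    real_inner_self_eq_norm_sq, norm_smul, mul_pow, Real.norm_eq_abs, sq_abs] at h1
  have h2 := (abs_le.1 h1).2
  have h3 := hnonneg (x - (1 / (2 * L)) • gradient h x)
  have h4 : L * ((1 / (2 * L)) ^ 2 * ‖gradient h x‖ ^ 2) = ‖gradient h x‖ ^ 2 / (4 * L) := by
    field_simp; ring
  have h5 : 1 / (2 * L) * ‖gradient h x‖ ^ 2 = 2 * (‖gradient h x‖ ^ 2 / (4 * L)) := by
    field_simp; ring
  have h6 : ‖gradient h x‖ ^ 2 / (4 * L) ≤ h x := by linarith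
  rw [div_le_iff₀ (by positivity)] at h6
  linarith

/-- At a minimizer `x` of `f + h ∘ e` over a convex set, with `h` smooth and `e` Lipschitz, the
directional derivatives of `f` are bounded below through the gradient of `h` at `e x`. -/
theorem HasDirDeriv.neg_le_of_isMinOn_add_comp {p d : ℕ} {Θ : Set (E p)} (hΘ : Convex ℝ Θ)
    {L C : ℝ} (hL : 0 ≤ L) (hC : 0 ≤ C) {e : E p → E d} (he : LipschitzWith C.toNNReal e)
    {f : E p → ℝ} {h : E d → ℝ} (hh : LSmooth L h) {x y : E p} (hx : x ∈ Θ) (hy : y ∈ Θ)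
    (hmin : IsMinOn (fun θ => f θ + h (e θ)) Θ x) {l : ℝ} (hl : HasDirDeriv f x (y - x) l) :
    -(C * ‖gradient h (e x)‖ * ‖y - x‖) ≤ l := by
  have hlim : Tendsto (fun t : ℝ => -(C * ‖gradient h (e x)‖ * ‖y - x‖)
      - t * (L * (C * ‖y - x‖) ^ 2)) (𝓝[>] (0 : ℝ))
      (𝓝 (-(C * ‖gradient h (e x)‖ * ‖y - x‖))) := by
    refine Tendsto.mono_left ?_ nhdsWithin_le_nhds
    refine Continuous.tendsto' (by fun_prop) _ _ (by simp)
  refine le_of_tendsto_of_tendsto hlim hl ?_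
  filter_upwards [Ioc_mem_nhdsGT (zero_lt_one (α := ℝ))] with t ht
  have hmem : x + t • (y - x) ∈ Θ := hΘ.add_smul_sub_mem hx hy ⟨ht.1.le, ht.2⟩
  have h1 : f x + h (e x) ≤ f (x + t • (y - x)) + h (e (x + t • (y - x))) := hmin hmem
  have h2 := (abs_le.1 (hh.abs_sub_sub_inner_le hL (e x) (e (x + t • (y - x))))).2
  have h3 := real_inner_le_norm (gradient h (e x)) (e (x + t • (y - x)) - e x)
  have h4 : ‖e (x + t • (y - x)) - e x‖ ≤ t * (C * ‖y - x‖) := by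
    have h5 := he.dist_le_mul (x + t • (y - x)) x
    rw [dist_eq_norm, dist_eq_norm, Real.coe_toNNReal C hC, add_sub_cancel_left, norm_smul,
      Real.norm_of_nonneg ht.1.le] at h5
    linarith
  have h5 := mul_le_mul_of_nonneg_left h4 (norm_nonneg (gradient h (e x)))
  have h6 := mul_le_mul_of_nonneg_left (pow_le_pow_left₀ (norm_nonneg _) h4 2) hL
  rw [le_div_iff₀ ht.1]
  linarith

/-- Proposition 2.6: majorization-minimization for a composition `f = f' ∘ e`
with `e` a `C`-Lipschitz map and `gₙ = g'ₙ ∘ e` where `g'ₙ` is a majorizing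
first-order surrogate of `f'` near `e(θ_{n-1})`. The objective values are
non-increasing and the iterates satisfy the asymptotic stationary point
condition. -/
theorem mm_nonconvex_composition {p d : ℕ} (Θ : Set (E p)) (hΘ : Convex ℝ Θ)
    (L C : ℝ) (hL : 0 < L) (hC : 0 < C)
    (f' : E d → ℝ) (e : E p → E d) (he : LipschitzWith C.toNNReal e)
    (f : E p → ℝ) (hf : ∀ θ, f θ = f' (e θ))
    (hbdd : ∃ B, ∀ θ ∈ Θ, B ≤ f θ)
    (df : E p → E p → ℝ)
    (hdf : ∀ θ ∈ Θ, ∀ θ' ∈ Θ, HasDirDeriv f θ (θ' - θ) (df θ (θ' - θ)))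
    (θseq : ℕ → E p) (g' : ℕ → E d → ℝ)
    (hθ0 : θseq 0 ∈ Θ)
    (hsur : ∀ n : ℕ, MajSurrogate L f' (g' (n+1)) (e (θseq n)))
    (hmem : ∀ n : ℕ, θseq (n+1) ∈ Θ)
    (hmin : ∀ n : ℕ, IsMinOn (fun θ => g' (n+1) (e θ)) Θ (θseq (n+1))) :
    Antitone (fun n => f (θseq n)) ∧ AsympStationary Θ df θseq := by
  have hdesc : ∀ n, f (θseq (n + 1)) + (g' (n + 1) (e (θseq (n + 1))) - f' (e (θseq (n + 1))))
      ≤ f (θseq n) := by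
    intro n
    have hmem_n : θseq n ∈ Θ := by
      cases n with
      | zero => exact hθ0
      | succ k => exact hmem k
    have h1 : g' (n + 1) (e (θseq (n + 1))) ≤ g' (n + 1) (e (θseq n)) := hmin n hmem_n
    have h2 := (hsur n).2.2.1
    rw [hf, hf]
    linarith
  have hanti : Antitone (fun n => f (θseq n)) :=
    antitone_nat_of_succ_le fun n => by
      have h1 := hdesc n
      have h2 := (hsur n).1 (e (θseq (n + 1)))
      linarith
  refine ⟨hanti, fun ε hε => ?_⟩
  have hdiff : Tendsto (fun n => f (θseq n) - f (θseq (n + 1))) atTop (𝓝 0) := by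
    obtain ⟨B, hB⟩ := hbdd
    have hbelow : BddBelow (range fun n => f (θseq n)) := by
      refine ⟨B, ?_⟩
      rintro _ ⟨n, rfl⟩
      cases n with
      | zero => exact hB _ hθ0
      | succ k => exact hB _ (hmem k)
    have h1 := tendsto_atTop_ciInf hanti hbelow
    simpa using h1.sub (h1.comp (tendsto_add_atTop_nat 1))
  have hδ : 0 < (ε / C) ^ 2 / (4 * L) := by positivity
  obtain ⟨N, hN⟩ := eventually_atTop.1 (hdiff.eventually_lt_const hδ)
  refine ⟨N + 1, fun n hn θ hθ hne => ?_⟩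
  obtain ⟨m, rfl⟩ : ∃ m, n = m + 1 := ⟨n - 1, by omega⟩
  obtain ⟨hmaj, hsmooth, -, -⟩ := hsur m
  have hgrad := hsmooth.norm_gradient_sq_le hL (fun x => sub_nonneg.2 (hmaj x))
    (e (θseq (m + 1)))
  have hsmall := hN m (by omega)
  rw [lt_div_iff₀ (by positivity)] at hsmall
  have hle := mul_le_mul_of_nonneg_left (hdesc m) hL.le
  have hG := abs_le_of_sq_le_sq (hgrad.trans (by linarith)) (by positivity : 0 ≤ ε / C)
  rw [abs_norm] at hG
  rw [le_div_iff₀ hC] at hG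
  have hmin' : IsMinOn (fun θ => f θ + (g' (m + 1) (e θ) - f' (e θ))) Θ (θseq (m + 1)) := by
    simpa [hf] using hmin m
  have hdir := HasDirDeriv.neg_le_of_isMinOn_add_comp hΘ hL.le hC.le he hsmooth (hmem m) hθ hmin'
    (hdf _ (hmem m) _ hθ)
  have hpos : 0 < ‖θ - θseq (m + 1)‖ := norm_pos_iff.2 (sub_ne_zero.2 hne)
  rw [ge_iff_le, le_div_iff₀ hpos]
  have := mul_le_mul_of_nonneg_right hG hpos.le
  linarith
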